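/- For every instance with n ≥ 4 agents, a finite set M of indivisible chores, and additive bi-valued cost functions — i.e., there exist constants a, b ≥ 0 such that c_i(e) ∈ {a, b} for every agent i and item e — there exists an (n−1)-EFX allocation: an allocation X = (X_1,…,X_n) of M such that for all agents i, j and every e ∈ X_i, c_i(X_i \ {e}) ≤ (n−1)·c_i(X_j). -/

import Mathlib

open Finset

/-- The number of items of `M ∩ S` that the assignment `w` gives to agent `i`. -/
def cnt {ι α : Type*} [DecidableEq ι] [DecidableEq α] (M : Finset ι) (w : ι → α) (i : α)
    (S : Finset ι) : ℕ :=
  #{e ∈ M | w e = i ∧ e ∈ S}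

section Counting

variable {ι α : Type*} [DecidableEq ι] [DecidableEq α]

theorem cnt_update (M : Finset ι) (w : ι → α) {e : ι} (he : e ∈ M) (j z : α) (S : Finset ι) :
    cnt M (Function.update w e j) z S + (if z = w e ∧ e ∈ S then 1 else 0) =
      cnt M w z S + (if z = j ∧ e ∈ S then 1 else 0) := by
  have split : ∀ v : ι → α, cnt M v z S =
      cnt (M.erase e) v z S + (if z = v e ∧ e ∈ S then 1 else 0) := by
    intro v
    unfold cnt
    conv_lhs => rw [← insert_erase he, filter_insert]
    by_cases h : v e = z ∧ e ∈ S
    · rw [if_pos h, if_pos ⟨h.1.symm, h.2⟩, card_insert_of_notMem (by simp)]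
    · rw [if_neg h, if_neg (fun h' => h ⟨h'.1.symm, h'.2⟩), add_zero]
  have hrest : cnt (M.erase e) (Function.update w e j) z S = cnt (M.erase e) w z S := by
    unfold cnt
    congr 1
    apply filter_congr
    intro f hf
    rw [Function.update_of_ne (ne_of_mem_erase hf)]
  rw [split w, split (Function.update w e j), hrest, Function.update_self]
  omega

theorem cnt_le_size (M : Finset ι) (w : ι → α) (i : α) (S : Finset ι) :
    cnt M w i S ≤ cnt M w i M :=
  card_le_card fun e he => by simp only [mem_filter] at he ⊢; tauto

theorem exists_mem_of_cnt_pos {M : Finset ι} {w : ι → α} {i : α} {S : Finset ι}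
    (h : 1 ≤ cnt M w i S) : ∃ e ∈ M, w e = i ∧ e ∈ S := by
  obtain ⟨e, he⟩ := card_pos.1 h
  exact ⟨e, by simpa using he⟩

theorem exists_mem_of_cnt_lt_size {M : Finset ι} {w : ι → α} {i : α} {S : Finset ι}
    (h : cnt M w i S < cnt M w i M) : ∃ e ∈ M, w e = i ∧ e ∉ S := by
  by_contra! hc
  refine h.not_ge (card_le_card fun e he => ?_)
  simp only [mem_filter] at he ⊢
  exact ⟨he.1, he.2.1, hc e he.1 he.2.1⟩

theorem cnt_mono_of_forall {M : Finset ι} {w : ι → α} {i : α} {S T : Finset ι}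
    (h : ∀ e ∈ M, w e = i → e ∈ S → e ∈ T) : cnt M w i S ≤ cnt M w i T :=
  card_le_card fun e he => by
    simp only [mem_filter] at he ⊢
    exact ⟨he.1, he.2.1, h e he.1 he.2.1 he.2.2⟩

theorem sum_cnt_size [Fintype α] (M : Finset ι) (w : ι → α) : ∑ i, cnt M w i M = #M := by
  rw [card_eq_sum_card_fiberwise (f := w) (t := univ) (by simp)]
  refine sum_congr rfl fun i _ => ?_
  unfold cnt
  congr 1
  apply filter_congr
  simp +contextual

/-- Minimizers for the lexicographic order of three natural valued functions. -/
theorem exists_lex_min {β : Type*} {P : β → Prop} (hP : ∃ x, P x) (f₁ f₂ f₃ : β → ℕ) :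
    ∃ x, P x ∧ ∀ y, P y → f₁ x ≤ f₁ y ∧ (f₁ y ≤ f₁ x → f₂ x ≤ f₂ y ∧
      (f₂ y ≤ f₂ x → f₃ x ≤ f₃ y)) := by
  have key : ∀ {Q : β → Prop} (_ : ∃ x, Q x) (f : β → ℕ), ∃ x, Q x ∧ ∀ y, Q y → f x ≤ f y := by
    intro Q ⟨x₀, hx₀⟩ f
    obtain ⟨x, hx, hm⟩ := (measure f).wf.has_min {x | Q x} ⟨x₀, hx₀⟩
    exact ⟨x, hx, fun y hy => not_lt.1 (hm y hy)⟩
  obtain ⟨x, hx, h₁⟩ := key hP f₁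
  obtain ⟨y, ⟨hy, hy₁⟩, h₂⟩ := key (Q := fun y => P y ∧ f₁ y ≤ f₁ x) ⟨x, hx, le_rfl⟩ f₂
  obtain ⟨z, ⟨hz, hz₁, hz₂⟩, h₃⟩ :=
    key (Q := fun z => P z ∧ f₁ z ≤ f₁ x ∧ f₂ z ≤ f₂ y) ⟨y, hy, hy₁, le_rfl⟩ f₃
  refine ⟨z, hz, fun v hv => ⟨hz₁.trans (h₁ v hv), fun hv₁ => ?_⟩⟩
  have hv₁' : f₁ v ≤ f₁ x := hv₁.trans hz₁
  exact ⟨hz₂.trans (h₂ v ⟨hv, hv₁'⟩), fun hv₂ => h₃ v ⟨hv, hv₁', hv₂.trans hz₂⟩⟩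

theorem sum_sq_cnt_update_lt [Fintype α] {M : Finset ι} {w : ι → α} {e : ι} (he : e ∈ M) {j : α}
    (h : cnt M w j M + 2 ≤ cnt M w (w e) M) :
    ∑ z, (cnt M (Function.update w e j) z M) ^ 2 < ∑ z, (cnt M w z M) ^ 2 := by
  generalize hei : w e = i at h
  have hu := fun z => cnt_update M w he j z M
  simp only [he, and_true, hei] at hu
  have hij : i ≠ j := by rintro rfl; omega
  have hs : ∑ z, ((cnt M (Function.update w e j) z M) ^ 2 +
        (if z = i then 2 * cnt M w i M - 1 else 0)) ≤
      ∑ z, ((cnt M w z M) ^ 2 + (if z = j then 2 * cnt M w j M + 1 else 0)) := by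
    refine sum_le_sum fun z _ => ?_
    have := hu z
    by_cases hzi : z = i
    · subst hzi
      simp only [if_true, hij, if_false] at this ⊢
      obtain ⟨c, hc⟩ : ∃ c, cnt M w z M = c + 1 := ⟨cnt M w z M - 1, by omega⟩
      have h' : cnt M (Function.update w e j) z M = c := by omega
      rw [h', hc]
      have : 2 * (c + 1) - 1 = 2 * c + 1 := by omega
      rw [this]; nlinarith
    · by_cases hzj : z = j
      · subst hzj
        simp only [hzi, if_true, if_false] at this ⊢
        have h' : cnt M (Function.update w e z) z M = cnt M w z M + 1 := by omega
        rw [h']; nlinarith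
      · simp only [hzi, hzj, if_false, add_zero] at this ⊢
        rw [this]
  simp only [sum_add_distrib, sum_ite_eq', mem_univ, if_true] at hs
  omega

/-- A finite set can be split into parts of almost equal size. -/
theorem exists_equitable_assignment [Fintype α] [Nonempty α] (M : Finset ι) {q : ℕ}
    (h₁ : Fintype.card α * q ≤ #M) (h₂ : #M ≤ Fintype.card α * (q + 1)) :
    ∃ w : ι → α, ∀ i, q ≤ cnt M w i M ∧ cnt M w i M ≤ q + 1 := by
  obtain ⟨w, -, hw⟩ := exists_lex_min (P := fun _ : ι → α => True)
    ⟨fun _ => Classical.arbitrary α, trivial⟩ (fun w => ∑ i, (cnt M w i M) ^ 2) 0 0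
  have hpair : ∀ i j, cnt M w i M ≤ cnt M w j M + 1 := by
    intro i j
    by_contra! h
    obtain ⟨e, he, hei, -⟩ := exists_mem_of_cnt_pos (M := M) (w := w) (i := i) (S := M) (by omega)
    exact (sum_sq_cnt_update_lt he (hei ▸ h)).not_ge (hw _ trivial).1
  refine ⟨w, fun i => ?_⟩
  have hsum := sum_cnt_size M w
  constructor
  · by_contra! h
    have : ∑ j, cnt M w j M < ∑ _j : α, q := sum_lt_sum
      (fun j _ => by have := hpair j i; omega) ⟨i, mem_univ _, h⟩
    simp at this; omega
  · by_contra! h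
    have : ∑ _j : α, (q + 1) < ∑ j, cnt M w j M := sum_lt_sum
      (fun j _ => by have := hpair i j; omega) ⟨i, mem_univ _, by omega⟩
    simp at this
    omega


theorem exists_cnt_swap (M : Finset ι) (w : ι → α) {e f : ι} (he : e ∈ M) (hf : f ∈ M)
    (hne : w e ≠ w f) : ∃ w' : ι → α, ∀ z S,
      cnt M w' z S + (if z = w e ∧ e ∈ S then 1 else 0) + (if z = w f ∧ f ∈ S then 1 else 0) =
        cnt M w z S + (if z = w f ∧ e ∈ S then 1 else 0) +
          (if z = w e ∧ f ∈ S then 1 else 0) := by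
  refine ⟨Function.update (Function.update w e (w f)) f (w e), fun z S => ?_⟩
  have h₁ := cnt_update M w he (w f) z S
  have h₂ := cnt_update M (Function.update w e (w f)) hf (w e) z S
  rw [Function.update_of_ne (by rintro rfl; exact hne rfl)] at h₂
  omega

/-- All bundles have size `q` or `q + 1`. -/
def BalancedSizes (M : Finset ι) (q : ℕ) (w : ι → α) : Prop :=
  ∀ i, q ≤ cnt M w i M ∧ cnt M w i M ≤ q + 1

/-- A balanced assignment that minimizes the total number of own large items, then the sum of
their squares, and then the number of items held by agents without large items. -/
structure Extremal [Fintype α] (M : Finset ι) (L : α → Finset ι) (q : ℕ) (w : ι → α) : Prop where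
  balanced : BalancedSizes M q w
  le_succ : ∀ w', BalancedSizes M q w' → ∀ x k, x ≠ k →
    (∀ z, cnt M w' z (L z) + (if z = x then 1 else 0) ≤
      cnt M w z (L z) + (if z = k then 1 else 0)) →
    cnt M w x (L x) ≤ cnt M w k (L k) + 1
  eq_of_le : ∀ w', BalancedSizes M q w' → (∀ z, cnt M w' z (L z) ≤ cnt M w z (L z)) →
    (∀ z, cnt M w' z (L z) = cnt M w z (L z)) ∧
    ∑ z, (if cnt M w z (L z) = 0 then cnt M w z M else 0) ≤
      ∑ z, (if cnt M w' z (L z) = 0 then cnt M w' z M else 0)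

theorem exists_extremal [Fintype α] [Nonempty α] (M : Finset ι) (L : α → Finset ι) {q : ℕ}
    (h₁ : Fintype.card α * q ≤ #M) (h₂ : #M ≤ Fintype.card α * (q + 1)) :
    ∃ w, Extremal M L q w := by
  obtain ⟨w, hw, hmin⟩ := exists_lex_min (P := BalancedSizes M q)
    (exists_equitable_assignment (α := α) M h₁ h₂)
    (fun w => ∑ z, cnt M w z (L z)) (fun w => ∑ z, (cnt M w z (L z)) ^ 2)
    (fun w => ∑ z, (if cnt M w z (L z) = 0 then cnt M w z M else 0))
  refine ⟨w, hw, ?_, ?_⟩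
  · intro w' hw' x k hxk hle
    obtain ⟨m₁, m₂⟩ := hmin w' hw'
    have hsum := sum_le_sum fun z (_ : z ∈ univ) => hle z
    simp only [sum_add_distrib, sum_ite_eq', mem_univ, if_true] at hsum
    have heq := (sum_eq_sum_iff_of_le fun z (_ : z ∈ univ) => hle z).1 (by
      simp only [sum_add_distrib, sum_ite_eq', mem_univ, if_true]
      omega)
    have hsq := (m₂ (by omega)).1
    have hs : ∑ z, ((cnt M w' z (L z)) ^ 2 + (if z = x then 2 * cnt M w x (L x) - 1 else 0)) ≤
        ∑ z, ((cnt M w z (L z)) ^ 2 + (if z = k then 2 * cnt M w k (L k) + 1 else 0)) := by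
      refine sum_le_sum fun z _ => ?_
      have := heq z (mem_univ _)
      by_cases hzx : z = x
      · subst hzx
        simp only [if_true, hxk, if_false, add_zero] at this ⊢
        rw [← this]
        have : 2 * (cnt M w' z (L z) + 1) - 1 = 2 * cnt M w' z (L z) + 1 := by omega
        rw [this]; nlinarith
      · by_cases hzk : z = k
        · subst hzk
          simp only [hzx, if_true, if_false, add_zero] at this ⊢
          rw [this]; nlinarith
        · simp only [hzx, hzk, if_false, add_zero] at this ⊢
          rw [this]
    simp only [sum_add_distrib, sum_ite_eq', mem_univ, if_true] at hs
    omega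
  · intro w' hw' hle
    obtain ⟨m₁, m₂⟩ := hmin w' hw'
    have heq := (sum_eq_sum_iff_of_le fun z (_ : z ∈ univ) => hle z).1
      (le_antisymm (sum_le_sum fun z _ => hle z) m₁)
    have heq' : ∀ z, cnt M w' z (L z) = cnt M w z (L z) := fun z => heq z (mem_univ _)
    refine ⟨heq', ?_⟩
    exact (m₂ (by simp [heq'])).2 (by simp [heq'])

section Extremal

variable [Fintype α] {M : Finset ι} {L : α → Finset ι} {q : ℕ} {w : ι → α}

theorem Extremal.own_le (hw : Extremal M L q w) {i j : α} (hij : i ≠ j) :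
    cnt M w i (L i) ≤ cnt M w j (L i) + 1 := by
  by_contra! h
  have hi := hw.balanced i
  have hj := hw.balanced j
  have hle := cnt_le_size M w i (L i)
  obtain ⟨e, he, hei, heL⟩ := exists_mem_of_cnt_pos (M := M) (w := w) (i := i) (S := L i) (by omega)
  by_cases hf : ∃ f ∈ M, w f = j ∧ f ∉ L i ∧ f ∈ L j
  · obtain ⟨f, hf, hfj, hfi, hfL⟩ := hf
    obtain ⟨w', hw'⟩ := exists_cnt_swap M w he hf (by rw [hei, hfj]; exact hij)
    rw [hei, hfj] at hw'
    have := (hw.eq_of_le w' (fun z => ?_) (fun z => ?_)).1 i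
    · have h' := hw' i (L i)
      simp [hij, heL, hfi] at h'
      omega
    · have h' := hw' z M
      have := hw.balanced z
      simp only [he, hf, and_true] at h'
      omega
    · have h' := hw' z (L z)
      by_cases hzi : z = i
      · subst hzi; simp [hij, heL, hfi] at h'; omega
      · by_cases hzj : z = j
        · subst hzj; simp [hij.symm, hfL] at h'; split_ifs at h' <;> omega
        · simp [hzi, hzj] at h'; omega
  · push Not at hf
    have hlj : cnt M w j (L j) ≤ cnt M w j (L i) := cnt_mono_of_forall fun e he hej heL => by
      by_contra hn
      exact hf e he hej hn heL
    obtain ⟨f, hf, hfj, hfi⟩ := exists_mem_of_cnt_lt_size (M := M) (w := w) (i := j) (S := L i)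
      (by omega)
    obtain ⟨w', hw'⟩ := exists_cnt_swap M w he hf (by rw [hei, hfj]; exact hij)
    rw [hei, hfj] at hw'
    have := hw.le_succ w' (fun z => ?_) i j hij (fun z => ?_)
    · omega
    · have h' := hw' z M
      have := hw.balanced z
      simp only [he, hf, and_true] at h'
      omega
    · have h' := hw' z (L z)
      by_cases hzi : z = i
      · subst hzi; simp [hij, heL, hfi] at h' ⊢; omega
      · by_cases hzj : z = j
        · subst hzj; simp [hij.symm] at h' ⊢; split_ifs at h' <;> omega
        · simp [hzi, hzj] at h' ⊢; omega

/-- Agent `x` can receive one more item at the expense of an agent without large items, by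
moving items only between agents of `O`, without increasing anyone's number of large items. -/
def Reaches (M : Finset ι) (L : α → Finset ι) (w : ι → α) (O : Finset α) (x : α) : Prop :=
  ∃ k, cnt M w k (L k) = 0 ∧ ∃ w' : ι → α,
    (∀ z, cnt M w' z M + (if z = k then 1 else 0) = cnt M w z M + (if z = x then 1 else 0)) ∧
    (∀ z, cnt M w' z (L z) ≤ cnt M w z (L z)) ∧
    (∀ e ∈ M, w e = x → w' e = x) ∧ ∀ z ∉ O, ∀ e ∈ M, w' e = z ↔ w e = z

theorem exists_closed_reaches (M : Finset ι) (L : α → Finset ι) (w : ι → α) :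
    ∃ O : Finset α, (∀ k, cnt M w k (L k) = 0 → k ∈ O) ∧ (∀ x ∈ O, Reaches M L w O x) ∧
      ∀ y ∉ O, ∀ x ∈ O, ∀ e ∈ M, w e = x → e ∈ L y := by
  let P : Finset α → Prop := fun O =>
    (∀ k, cnt M w k (L k) = 0 → k ∈ O) ∧ ∀ x ∈ O, Reaches M L w O x
  have hP : P {k | cnt M w k (L k) = 0} :=
    ⟨fun k hk => by simpa using hk, fun x hx => ⟨x, by simpa using hx, w, by simp⟩⟩
  obtain ⟨O, ⟨h₁, h₂⟩, hmin⟩ := exists_lex_min (P := P) ⟨_, hP⟩ (fun O => #Oᶜ) 0 0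
  refine ⟨O, h₁, h₂, fun y hy x hx f hf hfx => ?_⟩
  by_contra hfy
  have hxy : x ≠ y := by rintro rfl; exact hy hx
  have hlt : #(insert y O)ᶜ < #Oᶜ := card_lt_card <| by
    rw [compl_ssubset_compl]; exact ssubset_insert hy
  refine hlt.not_ge (hmin _ ⟨fun k hk => mem_insert_of_mem (h₁ k hk), fun t ht => ?_⟩).1
  rcases mem_insert.1 ht with rfl | ht
  · obtain ⟨k, hk, w', hs, hl, hx', hout⟩ := h₂ x hx
    have hw'f := hx' f hf hfx
    have hu := cnt_update M w' hf t
    rw [hw'f] at hu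
    refine ⟨k, hk, Function.update w' f t, fun z => ?_, fun z => ?_, fun e he het => ?_,
      fun z hz e he => ?_⟩
    · have := hu z M
      have := hs z
      simp only [hf, and_true] at *
      omega
    · have := hu z (L z)
      have := hl z
      by_cases hz : z = t
      · subst hz; simp [hfy] at this ‹_ + _ = _›; omega
      · simp [hz] at *; omega
    · have hef : e ≠ f := by rintro rfl; exact hxy (hfx.symm.trans het)
      rw [Function.update_of_ne hef]
      exact (hout t hy e he).2 het
    · rw [mem_insert, not_or] at hz
      by_cases hef : e = f
      · subst hef
        rw [Function.update_self, hfx]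
        exact ⟨fun h => (hz.1 h.symm).elim, fun h => (hz.2 (h ▸ hx)).elim⟩
      · rw [Function.update_of_ne hef]
        exact hout z hz.2 e he
  · obtain ⟨k, hk, w', hs, hl, hx', hout⟩ := h₂ t ht
    exact ⟨k, hk, w', hs, hl, hx', fun z hz => hout z fun h => hz (mem_insert_of_mem h)⟩

theorem Extremal.own_le_one_of_reaches (hw : Extremal M L q w) {O : Finset α} {x : α}
    (hx : Reaches M L w O x) : cnt M w x (L x) ≤ 1 := by
  by_contra! h
  obtain ⟨k, hk, w', hs, hl, hx', -⟩ := hx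
  have hxk : x ≠ k := by rintro rfl; omega
  obtain ⟨e, he, hex, heL⟩ := exists_mem_of_cnt_pos (M := M) (w := w) (i := x) (S := L x) (by omega)
  have hu := cnt_update M w' he k
  rw [hx' e he hex] at hu
  have := hw.le_succ (Function.update w' e k) (fun z => ?_) x k hxk (fun z => ?_)
  · omega
  · have h₁ := hu z M
    have := hs z
    have := hw.balanced z
    simp only [he, and_true] at h₁
    omega
  · have h₁ := hu z (L z)
    have := hl z
    by_cases hzx : z = x
    · subst hzx; simp [hxk, heL] at h₁ ⊢; omega
    · by_cases hzk : z = k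
      · subst hzk; simp [hzx] at h₁ ⊢; split_ifs at h₁ <;> omega
      · simp [hzx, hzk] at h₁ ⊢; omega

theorem Extremal.exists_pure_of_reaches (hw : Extremal M L q w) {O : Finset α} {x : α}
    (hx : Reaches M L w O x) (hq : cnt M w x M = q) :
    ∃ k, cnt M w k (L k) = 0 ∧ cnt M w k M = q := by
  by_contra! hc
  obtain ⟨k, hk, w', hs, hl, -, -⟩ := hx
  have hkx : k ≠ x := by rintro rfl; exact hc _ hk hq
  have hbk := hw.balanced k
  have hck := hc k hk
  have hlx : cnt M w x (L x) ≠ 0 := fun h => hc x h hq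
  obtain ⟨heq, hle⟩ := hw.eq_of_le w' (fun z => by
    have h := hs z
    have := hw.balanced z
    by_cases hzk : z = k
    · subst hzk; simp [hkx] at h; omega
    · by_cases hzx : z = x
      · subst hzx; simp [hzk] at h; omega
      · simp [hzk, hzx] at h; omega) hl
  refine hle.not_gt (sum_lt_sum (fun z _ => ?_) ⟨k, mem_univ _, ?_⟩)
  · have h := hs z
    rw [heq]
    split_ifs with h0
    · have hzx : z ≠ x := by rintro rfl; exact hlx h0
      simp [hzx] at h; omega
    · rfl
  · have h := hs k
    rw [heq]
    simp [hkx, hk] at h ⊢; omega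

/-- A balanced assignment together with a set `O` of agents having at most one large item, such
that everyone outside `O` considers items in every other bundle large. -/
theorem exists_balanced_partition [Nonempty α] (M : Finset ι) (L : α → Finset ι) {q : ℕ}
    (hq : 1 ≤ q) (h₁ : Fintype.card α * q ≤ #M) (h₂ : #M ≤ Fintype.card α * (q + 1)) :
    ∃ (w : ι → α) (O : Finset α), BalancedSizes M q w ∧
      (∀ i j, i ≠ j → cnt M w i (L i) ≤ cnt M w j (L i) + 1) ∧
      (∀ x ∈ O, cnt M w x (L x) ≤ 1) ∧
      (∀ y ∉ O, ∀ j, y ≠ j → 1 ≤ cnt M w j (L y) ∧ (j ∈ O → 2 ≤ cnt M w j (L y))) ∧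
      (∀ k, cnt M w k (L k) = 0 → k ∈ O) ∧
      (O.Nonempty → ∃ k, cnt M w k (L k) = 0) ∧
      (∀ x ∈ O, cnt M w x M = q → ∃ k, cnt M w k (L k) = 0 ∧ cnt M w k M = q) := by
  obtain ⟨w, hw⟩ := exists_extremal M L h₁ h₂
  obtain ⟨O, hO, hreach, hout⟩ := exists_closed_reaches M L w
  by_cases hx : ∃ x ∈ O, cnt M w x M = 1
  · obtain ⟨x, hx, hx1⟩ := hx
    have hq1 : q = 1 := by have := hw.balanced x; omega
    obtain ⟨k₀, hk₀⟩ := hw.exists_pure_of_reaches (hreach x hx) (by omega)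
    refine ⟨w, univ, hw.balanced, fun i j => hw.own_le, fun z _ => ?_, by simp, by simp,
      fun _ => ⟨k₀, hk₀.1⟩, fun _ _ _ => ⟨k₀, hk₀⟩⟩
    by_cases hz : z ∈ O
    · exact hw.own_le_one_of_reaches (hreach z hz)
    by_contra! h
    obtain ⟨k, hk, w', hs, hl, hx', hfix⟩ := hreach x hx
    have hzx : z ≠ x := by rintro rfl; exact hz hx
    have hzk : z ≠ k := by rintro rfl; exact hz (hO _ hk)
    obtain ⟨e, he, hez, heL⟩ :=
      exists_mem_of_cnt_pos (M := M) (w := w) (i := z) (S := L z) (by omega)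
    have hu := cnt_update M w' he k
    rw [(hfix z hz e he).2 hez] at hu
    have hzs : cnt M w z M = 2 := by
      have := hw.balanced z
      have := cnt_le_size M w z (L z)
      omega
    have := hw.le_succ (Function.update w' e k) (fun t => ?_) z k hzk (fun t => ?_)
    · omega
    · have h₁ := hu t M
      have h₂ := hs t
      have := hw.balanced t
      simp only [he, and_true] at h₁
      by_cases htx : t = x
      · subst htx; simp [hzx.symm] at h₁ h₂; omega
      · by_cases htz : t = z
        · subst htz; simp [htx] at h₁ h₂; omega
        · simp [htx, htz] at h₁ h₂; omega
    · have h₁ := hu t (L t)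
      have := hl t
      by_cases htz : t = z
      · subst htz; simp [hzk, heL] at h₁ ⊢; omega
      · by_cases htk : t = k
        · subst htk; simp [htz] at h₁ ⊢; split_ifs at h₁ <;> omega
        · simp [htz, htk] at h₁ ⊢; omega
  · push Not at hx
    refine ⟨w, O, hw.balanced, fun i j => hw.own_le,
      fun x hx => hw.own_le_one_of_reaches (hreach x hx), fun y hy j hyj => ?_, hO, ?_,
      fun x hx hxq => hw.exists_pure_of_reaches (hreach x hx) hxq⟩
    · by_cases hj : j ∈ O
      · have hle : cnt M w j M ≤ cnt M w j (L y) :=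
          cnt_mono_of_forall fun e he hej _ => hout y hy j hj e he hej
        have := hx j hj
        have := hw.balanced j
        exact ⟨by omega, fun _ => by omega⟩
      · refine ⟨?_, fun h => (hj h).elim⟩
        by_contra! h0
        have hy1 := hw.own_le hyj
        have hy0 : cnt M w y (L y) ≠ 0 := fun h => hy (hO y h)
        have hj0 : cnt M w j (L j) ≠ 0 := fun h => hj (hO j h)
        obtain ⟨e, he, hey, heL⟩ :=
          exists_mem_of_cnt_pos (M := M) (w := w) (i := y) (S := L y) (by omega)
        obtain ⟨f, hf, hfj, hfL⟩ :=
          exists_mem_of_cnt_pos (M := M) (w := w) (i := j) (S := L j) (by omega)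
        have hfy : f ∉ L y := fun h => by
          have : 0 < cnt M w j (L y) := card_pos.2 ⟨f, by simp [hf, hfj, h]⟩
          omega
        obtain ⟨w', hw'⟩ := exists_cnt_swap M w he hf (by rw [hey, hfj]; exact hyj)
        rw [hey, hfj] at hw'
        have := (hw.eq_of_le w' (fun z => ?_) (fun z => ?_)).1 y
        · have h' := hw' y (L y)
          simp [hyj, heL, hfy] at h'
          omega
        · have h' := hw' z M
          have := hw.balanced z
          simp only [he, hf, and_true] at h'
          omega
        · have h' := hw' z (L z)
          by_cases hzi : z = y
          · subst hzi; simp [hyj, heL, hfy] at h'; omega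
          · by_cases hzj : z = j
            · subst hzj; simp [hyj.symm, hfL] at h'; split_ifs at h' <;> omega
            · simp [hzi, hzj] at h'; omega
    · rintro ⟨x, hx⟩
      obtain ⟨k, hk, -⟩ := hreach x hx
      exact ⟨k, hk⟩

end Extremal


theorem cnt_union_image {M : Finset ι} {A : Finset α} {ε : α → ι} (hε : Set.InjOn ε A)
    (hM : ∀ i ∈ A, ε i ∉ M) {v w : ι → α} {δ : α → α}
    (hv : ∀ e ∈ M, v e = w e) (hδ : ∀ i ∈ A, v (ε i) = δ i)
    (z : α) (S : Finset ι) :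
    cnt (M ∪ A.image ε) v z S = cnt M w z S + #{i ∈ A | δ i = z ∧ ε i ∈ S} := by
  unfold cnt
  rw [filter_union, card_union_of_disjoint]
  · congr 1
    · congr 1
      apply filter_congr
      intro e he
      rw [hv e he]
    · rw [filter_image, card_image_of_injOn (hε.mono (by simp [Set.subset_def]; tauto))]
      congr 1
      apply filter_congr
      intro i hi
      rw [hδ i hi]
  · refine disjoint_filter_filter (disjoint_right.2 fun e he => ?_)
    obtain ⟨i, hi, rfl⟩ := mem_image.1 he
    exact hM i hi

/-- Extend an assignment of `M` by the items `ε i`, `i ∈ A`, where `ε i` is given to `δ i`. -/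
theorem exists_extend {M : Finset ι} {A : Finset α} {ε : α → ι} (hε : Set.InjOn ε A)
    (hM : ∀ i ∈ A, ε i ∉ M) (w : ι → α) (δ : α → α) :
    ∃ v : ι → α, (∀ e ∈ M, v e = w e) ∧ (∀ i ∈ A, v (ε i) = δ i) ∧ ∀ z S,
      cnt (M ∪ A.image ε) v z S = cnt M w z S + #{i ∈ A | δ i = z ∧ ε i ∈ S} := by
  classical
  let v : ι → α := fun e => if h : ∃ i ∈ A, ε i = e then δ h.choose else w e
  have hv : ∀ e ∈ M, v e = w e := fun e he => by
    refine dif_neg ?_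
    rintro ⟨i, hi, rfl⟩
    exact hM i hi he
  have hδ : ∀ i ∈ A, v (ε i) = δ i := fun i hi => by
    have h : ∃ j ∈ A, ε j = ε i := ⟨i, hi, rfl⟩
    have := hε h.choose_spec.1 hi h.choose_spec.2
    simp only [v, dif_pos h, this]
  exact ⟨v, hv, hδ, cnt_union_image hε hM hv hδ⟩

theorem card_filter_eq_and (A : Finset α) (z : α) (P : α → Prop) [DecidablePred P] :
    #{i ∈ A | i = z ∧ P i} = if z ∈ A ∧ P z then 1 else 0 := by
  split_ifs with h
  · rw [card_eq_one]
    refine ⟨z, ?_⟩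
    ext i
    simp only [mem_filter, mem_singleton]
    constructor
    · exact fun h => h.2.1
    · rintro rfl; exact ⟨h.1, rfl, h.2⟩
  · rw [card_eq_zero, filter_eq_empty_iff]
    rintro i hi ⟨rfl, hP⟩
    exact h ⟨hi, hP⟩

/-- The agents of `N` take a common large item only if there are at least two of them; this allows
to dump further items on `N` evenly. -/
theorem exists_dump [Fintype α] {p : ℕ} (hp : 3 ≤ p) (hcard : Fintype.card α = p + 1)
    {N : Finset α} (hN : N.Nonempty) :
    ∃ A : Finset α, p ≤ #A ∧ Nᶜ ⊆ A ∧ (∀ u ∈ N, ∀ j, j ≠ u → j ∈ A) ∧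
      ∀ D : Finset α, (∀ i ∈ D, i ∉ N) → ∃ δ : α → α, (∀ i, δ i ∈ N) ∧
        ∀ u ∈ N, #{i ∈ D | δ i = u} + (if u ∈ A then 1 else 0) ≤ p - 1 ∨
          (#{i ∈ D | δ i = u} + (if u ∈ A then 1 else 0) ≤ p ∧ ∀ j, j ≠ u → j ∈ D) := by
  obtain ⟨u, hu⟩ := hN
  by_cases h1 : ∃ v ∈ N, v ≠ u
  · obtain ⟨v, hv, hvu⟩ := h1
    refine ⟨univ, by simp [hcard], subset_univ _, by simp, fun D hD => ?_⟩
    rcases D.eq_empty_or_nonempty with rfl | ⟨i₀, hi₀⟩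
    · exact ⟨fun _ => u, fun _ => hu, fun x hx => Or.inl (by simp; omega)⟩
    refine ⟨fun i => if i = i₀ then v else u, fun i => by dsimp only; split_ifs <;> assumption,
      fun x hx => Or.inl ?_⟩
    have hDc : #D + 2 ≤ p + 1 := by
      rw [← hcard, ← card_pair hvu, ← card_union_of_disjoint]
      · exact card_le_univ _
      · rw [disjoint_right]
        simp only [mem_insert, mem_singleton]
        rintro y (rfl | rfl) hy <;> exact hD _ hy ‹_›
    simp only [mem_univ, if_true]
    by_cases hxv : x = v
    · have : #{i ∈ D | (if i = i₀ then v else u) = x} ≤ #{i₀} := card_le_card fun i hi => by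
        simp only [mem_filter, mem_singleton] at hi ⊢
        by_contra h
        rw [if_neg h, hxv] at hi
        exact hvu hi.2.symm
      simp at this; omega
    · have : #{i ∈ D | (if i = i₀ then v else u) = x} ≤ #(D.erase i₀) :=
        card_le_card fun i hi => by
          simp only [mem_filter, mem_erase] at hi ⊢
          refine ⟨fun h => ?_, hi.1⟩
          rw [if_pos h] at hi
          exact hxv hi.2.symm
      rw [card_erase_of_mem hi₀] at this
      omega
  · push Not at h1
    have hNu : ∀ x ∈ N, x = u := h1
    refine ⟨univ.erase u, by simp [hcard], fun x hx => ?_, fun x hx j hj => ?_, fun D hD => ?_⟩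
    · simp only [mem_compl, mem_erase, mem_univ, and_true] at hx ⊢
      rintro rfl; exact hx hu
    · rw [hNu x hx] at hj; simp [hj]
    refine ⟨fun _ => u, fun _ => hu, fun x hx => ?_⟩
    obtain rfl := hNu x hx
    simp only [filter_true, mem_erase, mem_univ, and_true, ne_eq, not_true, if_false, add_zero]
    have hsub : D ⊆ univ.erase x := fun i hi => by
      simp only [mem_erase, mem_univ, and_true]
      rintro rfl; exact hD _ hi hu
    have hle := card_le_card hsub
    have hc : #(univ.erase x) = p := by simp [hcard]
    by_cases hDp : #D = p
    · right
      refine ⟨hDp.le, fun j hj => ?_⟩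
      rw [eq_of_subset_of_card_le hsub (by omega)]
      simp [hj]
    · left; omega

/-- Condition under which agents have a common supply of items large for all of `N` with each
agent outside `N` finding its own item small. -/
theorem exists_distinct_items [Fintype α] {M : Finset ι} {L : α → Finset ι} {N : Finset α}
    (h₁ : Fintype.card α ≤ #{e ∈ M | ∀ i ∈ N, e ∈ L i})
    (h₂ : ∀ Z : Finset α, Z.Nonempty → Disjoint N Z →
      #Z + #{e ∈ M | ∀ i ∈ N ∪ Z, e ∈ L i} ≤ #{e ∈ M | ∀ i ∈ N, e ∈ L i}) :
    ∃ ε : α → ι, Function.Injective ε ∧ (∀ i, ε i ∈ M) ∧ (∀ i, ∀ u ∈ N, ε i ∈ L u) ∧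
      ∀ i ∉ N, ε i ∉ L i := by
  let K : Finset ι := {e ∈ M | ∀ i ∈ N, e ∈ L i}
  let t : α → Finset ι := fun i => {e ∈ K | i ∉ N → e ∉ L i}
  obtain ⟨ε, hε, hmem⟩ := (Finset.all_card_le_biUnion_card_iff_exists_injective t).1 (fun Z => by
    by_cases hZ : Disjoint N Z
    · rcases Z.eq_empty_or_nonempty with rfl | hne
      · simp
      have hsub : K ⊆ Z.biUnion t ∪ {e ∈ M | ∀ i ∈ N ∪ Z, e ∈ L i} := fun e he => by
        by_cases hc : ∀ i ∈ Z, e ∈ L i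
        · simp only [K, mem_filter] at he
          refine mem_union_right _ (mem_filter.2 ⟨he.1, fun i hi => ?_⟩)
          exact (mem_union.1 hi).elim (he.2 i) (hc i)
        · push Not at hc
          obtain ⟨i, hi, hei⟩ := hc
          exact mem_union_left _ (mem_biUnion.2 ⟨i, hi, mem_filter.2 ⟨he, fun _ => hei⟩⟩)
      have := (card_le_card hsub).trans (card_union_le _ _)
      have := h₂ Z hne hZ
      change _ ≤ #K at this
      omega
    · obtain ⟨i, hiN, hiZ⟩ := not_disjoint_iff.1 hZ
      refine (card_le_univ Z).trans (h₁.trans (card_le_card fun e he => ?_))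
      exact mem_biUnion.2 ⟨i, hiZ, mem_filter.2 ⟨he, fun h => (h hiN).elim⟩⟩)
  refine ⟨ε, hε, fun i => ?_, fun i u hu => ?_, fun i hi => ?_⟩
  · exact (mem_filter.1 (mem_filter.1 (hmem i)).1).1
  · exact (mem_filter.1 (mem_filter.1 (hmem i)).1).2 u hu
  · exact (mem_filter.1 (hmem i)).2 hi

/-- If every agent can be given an item that is large for all of `N`, but small for its owner
outside `N`, then there is an allocation in which both the sizes and the numbers of large items
are within a factor of `p`. -/
theorem exists_of_distinct_items [Fintype α] {p s : ℕ} (hp : 3 ≤ p)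
    (hcard : Fintype.card α = p + 1) {M : Finset ι} {L : α → Finset ι} {N : Finset α}
    (hN : N.Nonempty) (hs : 1 ≤ s) (hM₁ : (p + 1) * (s + 1) ≤ #M)
    (hM₂ : #M ≤ (p + 1) * (s + 1) + p) {ε : α → ι} (hε : Function.Injective ε)
    (hεM : ∀ i, ε i ∈ M) (hεN : ∀ i, ∀ u ∈ N, ε i ∈ L u) (hεL : ∀ i ∉ N, ε i ∉ L i) :
    ∃ w : ι → α, ∀ i j, i ≠ j → cnt M w i M ≤ p * cnt M w j M + 1 ∧
      cnt M w i (L i) ≤ p * cnt M w j (L i) := by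
  have : Nonempty α := ⟨hN.choose⟩
  obtain ⟨A, hAc, hNA, hA, hdump⟩ := exists_dump hp hcard hN
  have hAsub : A.image ε ⊆ M := by
    intro e he
    obtain ⟨i, -, rfl⟩ := mem_image.1 he
    exact hεM i
  have hAle : #A ≤ p + 1 := hcard ▸ card_le_univ A
  have hM'c : #(M \ A.image ε) = #M - #A := by
    rw [card_sdiff_of_subset hAsub, card_image_of_injective _ hε]
  set M' := M \ A.image ε with hM'
  have hMM' : M = M' ∪ A.image ε := (sdiff_union_of_subset hAsub).symm
  have hexp : (p + 1) * (s + 1) = (p + 1) * s + (p + 1) := by ring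
  obtain ⟨w, O, hbal, hb, hc, hd, hpure, hex, hf⟩ := exists_balanced_partition M' L hs
    (by rw [hcard]; omega) (by rw [hcard]; omega)
  obtain ⟨D, hD⟩ : ∃ D : Finset α, ∀ i, i ∈ D ↔ i ∈ O ∧ i ∉ N ∧ cnt M' w i (L i) = 1 :=
    ⟨{i ∈ O | i ∉ N ∧ cnt M' w i (L i) = 1}, by simp⟩
  obtain ⟨δ, hδN, hδ⟩ := hdump D fun i hi => ((hD i).1 hi).2.1
  have hitem : ∀ i, ∃ e, i ∈ D → e ∈ M' ∧ w e = i ∧ e ∈ L i := fun i => by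
    by_cases hi : i ∈ D
    · obtain ⟨e, he⟩ := exists_mem_of_cnt_pos (((hD i).1 hi).2.2.ge)
      exact ⟨e, fun _ => he⟩
    · exact ⟨ε i, fun h => (hi h).elim⟩
  choose x hx using hitem
  have hxinj : Set.InjOn x D := fun i hi j hj hij => by
    rw [← (hx i hi).2.1, ← (hx j hj).2.1, hij]
  have hxsub : D.image x ⊆ M' := by
    intro e he
    obtain ⟨i, hi, rfl⟩ := mem_image.1 he
    exact (hx i hi).1
  have hMx : M' = (M' \ D.image x) ∪ D.image x := (sdiff_union_of_subset hxsub).symm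
  have hxnot : ∀ i ∈ D, x i ∉ M' \ D.image x := fun i hi h =>
    (mem_sdiff.1 h).2 (mem_image_of_mem _ hi)
  obtain ⟨v₁, -, -, hv₁⟩ := exists_extend hxinj hxnot w δ
  have hw₁ := cnt_union_image hxinj hxnot (v := w) (w := w) (δ := id) (fun _ _ => rfl)
    (fun i hi => (hx i hi).2.1)
  rw [← hMx] at hv₁ hw₁
  obtain ⟨v, -, -, hv⟩ := exists_extend (M := M') (A := A) hε.injOn
    (fun i hi h => (mem_sdiff.1 h).2 (mem_image_of_mem _ hi)) v₁ id
  rw [← hMM'] at hv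
  simp only [id] at hv hw₁
  simp only [card_filter_eq_and] at hv hw₁
  have hdz : ∀ (z : α) (S : Finset ι), #{i ∈ D | δ i = z ∧ x i ∈ S} ≤ #{i ∈ D | δ i = z} :=
    fun z S => card_le_card fun i hi => by simp only [mem_filter] at hi ⊢; exact ⟨hi.1, hi.2.1⟩
  have hd0 : ∀ z ∉ N, #{i ∈ D | δ i = z} = 0 := fun z hz => by
    rw [card_eq_zero, filter_eq_empty_iff]
    rintro i - rfl
    exact hz (hδN i)
  have hdM : ∀ z, #{i ∈ D | δ i = z ∧ x i ∈ M} = #{i ∈ D | δ i = z} := fun z => by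
    congr 1
    apply filter_congr
    intro i hi
    have : x i ∈ M := sdiff_subset (hx i hi).1
    simp [this]
  have hsz : ∀ z, cnt M' w z M = cnt M' w z M' := fun z => by
    unfold cnt
    congr 1
    apply filter_congr
    intro e he
    simp [he, (mem_sdiff.1 he).1]
  -- sizes and numbers of large items in the new assignment
  have hsize : ∀ z, cnt M v z M + (if z ∈ D then 1 else 0) =
      cnt M' w z M' + #{i ∈ D | δ i = z} + (if z ∈ A then 1 else 0) := fun z => by
    have h₁ := hv z M
    rw [hv₁, hdM] at h₁
    have h₂ := hw₁ z M
    rw [hsz] at h₂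
    simp only [hεM, and_true] at h₁
    by_cases hz : z ∈ D
    · have : x z ∈ M := sdiff_subset (hx z hz).1
      simp only [hz, this, and_self, if_true] at h₂ ⊢
      omega
    · simp only [hz, false_and, if_false] at h₂ ⊢
      omega
  have hown : ∀ z, cnt M v z (L z) + (if z ∈ D then 1 else 0) ≤
      cnt M' w z (L z) + #{i ∈ D | δ i = z} + (if z ∈ A ∧ ε z ∈ L z then 1 else 0) := fun z => by
    have h₁ := hv z (L z)
    rw [hv₁] at h₁
    have h₂ := hw₁ z (L z)
    have h₃ := hdz z (L z)
    by_cases hz : z ∈ D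
    · simp only [hz, (hx z hz).2.2, and_self, if_true] at h₂ ⊢
      omega
    · simp only [hz, false_and, if_false] at h₂ ⊢
      omega
  have hother : ∀ i j, cnt M' w j (L i) + (if j ∈ A ∧ ε j ∈ L i then 1 else 0) ≤
      cnt M v j (L i) + (if j ∈ D then 1 else 0) := fun i j => by
    have h₁ := hv j (L i)
    rw [hv₁] at h₁
    have h₂ := hw₁ j (L i)
    by_cases hj : j ∈ D
    · simp only [hj, if_true, true_and] at h₂ ⊢
      split_ifs at h₂ <;> omega
    · simp only [hj, false_and, if_false] at h₂ ⊢
      omega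
  have hother' : ∀ i j, j ∈ A → ε j ∈ L i → 1 ≤ cnt M v j (L i) := fun i j hj he => by
    have h₁ := hv j (L i)
    simp only [hj, he, and_self, if_true] at h₁
    omega
  have hDA : ∀ j ∈ D, j ∈ A := fun j hj => hNA (by simpa using ((hD j).1 hj).2.1)
  have hmin : ∀ j, s ≤ cnt M v j M := fun j => by
    have h₁ := hsize j
    have h₂ := hbal j
    by_cases hj : j ∈ D
    · simp only [hj, hDA j hj, if_true] at h₁; omega
    · simp only [hj, if_false] at h₁; omega
  have hps : p + s ≤ p * s + 1 := by nlinarith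
  refine ⟨v, fun i j hij => ?_⟩
  have hpj : p * s ≤ p * cnt M v j M := Nat.mul_le_mul_left _ (hmin j)
  have hbi := hbal i
  by_cases hiN : i ∈ N
  · have hiD : i ∉ D := fun h => ((hD i).1 h).2.1 hiN
    have hjA : j ∈ A := hA i hiN j hij.symm
    have hji := hεN j i hiN
    have hsi := hsize i
    have hoi := hown i
    have hg := hother i j
    have hg1 := hother' i j hjA hji
    have hpg := Nat.mul_le_mul_left p hg1
    simp only [hiD, if_false, hεN i i hiN, and_true, hjA, hji, and_self, if_true] at hsi hoi hg
    by_cases hiO : i ∈ O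
    · have hli := hc i hiO
      rcases hδ i hiN with hle | ⟨hle, hall⟩
      · constructor <;> omega
      · obtain ⟨k, hk⟩ := hex ⟨i, hiO⟩
        have hki : k = i := by
          by_contra hne
          have := ((hD k).1 (hall k hne)).2.2
          omega
        subst hki
        refine ⟨?_, by omega⟩
        have hjD := hall j hij.symm
        have hsj := hsize j
        have hbj := hbal j
        simp only [hjD, hjA, if_true] at hsj
        by_cases hs2 : 2 ≤ s
        · have : 2 * p ≤ p * s := by nlinarith
          have : p + s ≤ p * s := by nlinarith
          omega
        · have hs1 : s = 1 := by omega
          subst hs1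
          by_cases hk1 : cnt M' w k M' = 1
          · omega
          · have hj2 : 2 ≤ cnt M' w j M' := by
              by_contra! hlt
              obtain ⟨k', hk', hk'1⟩ := hf j ((hD j).1 hjD).1 (by omega)
              have : k' = k := by
                by_contra hne
                have := ((hD k').1 (hall k' hne)).2.2
                omega
              subst this
              exact hk1 hk'1
            have : p * 2 ≤ p * cnt M v j M := Nat.mul_le_mul_left _ (by omega)
            omega
    · have hle : #{t ∈ D | δ t = i} + (if i ∈ A then 1 else 0) ≤ p - 1 := by
        rcases hδ i hiN with hle | ⟨hle, hall⟩
        · exact hle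
        · exfalso
          obtain ⟨k, hk⟩ := hex ⟨j, ((hD j).1 (hall j hij.symm)).1⟩
          have hki : k = i := by
            by_contra hne
            have := ((hD k).1 (hall k hne)).2.2
            omega
          exact hiO (hki ▸ hpure k hk)
      have hbij := hb i j hij
      have hdij := hd i hiO j hij
      refine ⟨by omega, ?_⟩
      obtain ⟨γ, hγ⟩ : ∃ γ, cnt M v j (L i) = γ + 1 := ⟨cnt M v j (L i) - 1, by omega⟩
      have hγ1 : 1 ≤ γ := by
        by_cases hjD : j ∈ D
        · have := hdij.2 ((hD j).1 hjD).1
          simp only [hjD, if_true] at hg; omega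
        · simp only [hjD, if_false] at hg; omega
      have : cnt M' w i (L i) ≤ γ + 2 := by split_ifs at hg <;> omega
      have : p * (γ + 1) = p * γ + p := by ring
      rw [hγ, this]
      have : 3 * γ ≤ p * γ := Nat.mul_le_mul_right _ hp
      omega
  · have hiA : i ∈ A := hNA (by simpa using hiN)
    have hsi := hsize i
    have hoi := hown i
    have hg := hother i j
    simp only [hd0 i hiN, hiA, if_true, hεL i hiN, and_false, if_false, add_zero] at hsi hoi
    have h3s : 3 * s ≤ p * s := Nat.mul_le_mul_right _ hp
    refine ⟨by omega, ?_⟩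
    by_cases hiO : i ∈ O
    · have hli := hc i hiO
      by_cases hl : cnt M' w i (L i) = 1
      · have hiD : i ∈ D := (hD i).2 ⟨hiO, hiN, hl⟩
        simp only [hiD, if_true] at hoi
        have : cnt M v i (L i) = 0 := by omega
        rw [this]; exact Nat.zero_le _
      · have : cnt M v i (L i) = 0 := by omega
        rw [this]; exact Nat.zero_le _
    · have hbij := hb i j hij
      have hdij := hd i hiO j hij
      have h3 : 3 * cnt M v j (L i) ≤ p * cnt M v j (L i) := Nat.mul_le_mul_right _ hp
      by_cases hjD : j ∈ D
      · have := hdij.2 ((hD j).1 hjD).1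
        simp only [hjD, if_true] at hg; omega
      · simp only [hjD, if_false] at hg; omega


/-- Agent `i` does not envy agent `j` by more than a factor `p` after removal of any item of her
own bundle, when items in `L i` cost `a + d` and the others cost `a`. -/
def EnvyBounded (p : ℕ) (a d : ℝ) (M : Finset ι) (L : α → Finset ι) (w : ι → α) (i j : α) :
    Prop :=
  ∀ e ∈ M, w e = i →
    (cnt M w i M : ℝ) * a + cnt M w i (L i) * d - (a + if e ∈ L i then d else 0) ≤
      p * (cnt M w j M * a + cnt M w j (L i) * d)

section Envy

variable {p : ℕ} {a d : ℝ} {M : Finset ι} {L : α → Finset ι} {w : ι → α} {i j : α}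

theorem envyBounded_of_cost (hd : 0 ≤ d)
    (h : (cnt M w i M : ℝ) * a + cnt M w i (L i) * d ≤
      p * (cnt M w j M * a + cnt M w j (L i) * d) + a) : EnvyBounded p a d M L w i j := by
  intro e _ _
  have : 0 ≤ if e ∈ L i then d else 0 := by split_ifs <;> simp [hd]
  linarith

theorem envyBounded_of_counts (ha : 0 ≤ a) (hd : 0 ≤ d)
    (h₁ : cnt M w i M ≤ p * cnt M w j M + 1) (h₂ : cnt M w i (L i) ≤ p * cnt M w j (L i)) :
    EnvyBounded p a d M L w i j := by
  refine envyBounded_of_cost hd ?_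
  have h₁' : (cnt M w i M : ℝ) ≤ p * cnt M w j M + 1 := by exact_mod_cast h₁
  have h₂' : (cnt M w i (L i) : ℝ) ≤ p * cnt M w j (L i) := by exact_mod_cast h₂
  nlinarith [mul_le_mul_of_nonneg_right h₁' ha, mul_le_mul_of_nonneg_right h₂' hd]

theorem envyBounded_of_size (ha : 0 ≤ a) (hd : 0 ≤ d)
    (h₁ : cnt M w i M ≤ p * cnt M w j M + 1) (h₂ : cnt M w i M ≤ p * cnt M w j (L i) + 1) :
    EnvyBounded p a d M L w i j := by
  intro e he hei
  have h₁' : (cnt M w i M : ℝ) ≤ p * cnt M w j M + 1 := by exact_mod_cast h₁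
  have h₂' : (cnt M w i M : ℝ) ≤ p * cnt M w j (L i) + 1 := by exact_mod_cast h₂
  have h₃ : (cnt M w i (L i) : ℝ) * d - (if e ∈ L i then d else 0) ≤ (cnt M w i M - 1) * d := by
    split_ifs with h
    · have : (cnt M w i (L i) : ℝ) ≤ cnt M w i M := by exact_mod_cast cnt_le_size M w i (L i)
      nlinarith
    · have hlt : cnt M w i (L i) + 1 ≤ cnt M w i M := by
        refine card_lt_card ⟨fun f hf => ?_, fun hs => ?_⟩
        · simp only [mem_filter] at hf ⊢; tauto
        · have := hs (x := e) (by simp [he, hei])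
          simp only [mem_filter] at this
          exact h this.2.2
      have : (cnt M w i (L i) : ℝ) + 1 ≤ cnt M w i M := by exact_mod_cast hlt
      nlinarith
  nlinarith [mul_le_mul_of_nonneg_right h₁' ha, mul_le_mul_of_nonneg_right h₂' hd]

theorem envyBounded_of_size_le_one (ha : 0 ≤ a) (hd : 0 ≤ d) (h : cnt M w i M ≤ 1) :
    EnvyBounded p a d M L w i j :=
  envyBounded_of_size ha hd (by omega) (by omega)

end Envy

/-- Give the items of `B` as singletons to the agents of `A`, and the other items according to
`w`. -/
theorem exists_singletons {M B : Finset ι} (hB : B ⊆ M) {A : Finset α} (hc : #B = #A)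
    {w : ι → α} (hw : ∀ e ∈ M \ B, w e ∉ A) :
    ∃ v : ι → α, (∀ z ∈ A, ∀ S, B ⊆ S → cnt M v z S = 1) ∧
      ∀ z ∉ A, ∀ S, cnt M v z S = cnt (M \ B) w z S := by
  let φ : B ≃ A := Finset.equivOfCardEq hc
  refine ⟨fun e => if h : e ∈ B then φ ⟨e, h⟩ else w e, fun z hz S hS => ?_, fun z hz S => ?_⟩
  · refine card_eq_one.2 ⟨φ.symm ⟨z, hz⟩, ?_⟩
    ext e
    simp only [mem_filter, mem_singleton]
    constructor
    · rintro ⟨he, h, -⟩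
      split_ifs at h with heB
      · have : φ ⟨e, heB⟩ = ⟨z, hz⟩ := Subtype.ext h
        rw [← this]; simp
      · exact (hw e (mem_sdiff.2 ⟨he, heB⟩) (h ▸ hz)).elim
    · intro h
      have heB : e ∈ B := h ▸ (φ.symm ⟨z, hz⟩).2
      refine ⟨hB heB, ?_, hS heB⟩
      have : (⟨e, heB⟩ : B) = φ.symm ⟨z, hz⟩ := Subtype.ext h
      simp [heB, this]
  · unfold cnt
    congr 1
    ext e
    simp only [mem_filter, mem_sdiff]
    by_cases heB : e ∈ B
    · simp only [heB, dif_pos, not_true, and_false, false_and, iff_false]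
      rintro ⟨-, h, -⟩
      exact hz (h ▸ (φ ⟨e, heB⟩).2)
    · simp [heB]

theorem cnt_const (M : Finset ι) (u : α) (S : Finset ι) :
    cnt M (fun _ => u) u S = #(M ∩ S) := by
  unfold cnt
  congr 1
  ext e
  simp

section Cases

variable [Fintype α] {p : ℕ} {a d : ℝ} {M : Finset ι} {L : α → Finset ι}

/-- All agents but `u` receive exactly one item of `B`. -/
theorem exists_of_all_but_one (hcard : Fintype.card α = p + 1) (ha : 0 ≤ a) (hd : 0 ≤ d) (u : α)
    {B : Finset ι} (hB : B ⊆ M) (hBp : #B = p)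
    (h : ∀ (w : ι → α) (j : α), cnt M w u M + p = #M → cnt M w u (L u) = #((M \ B) ∩ L u) →
      cnt M w j M = 1 → (B ⊆ L u → cnt M w j (L u) = 1) → EnvyBounded p a d M L w u j) :
    ∃ w : ι → α, ∀ i j, i ≠ j → EnvyBounded p a d M L w i j := by
  obtain ⟨v, hv₁, hv₂⟩ := exists_singletons (A := univ.erase u) (w := fun _ => u) hB
    (by simp [hBp, hcard]) (by simp)
  refine ⟨v, fun i j hij => ?_⟩
  by_cases hi : i = u
  · subst hi
    have hj : j ∈ univ.erase i := by simp [hij.symm]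
    refine h v j ?_ ?_ (hv₁ j hj M hB) (hv₁ j hj (L i))
    · rw [hv₂ i (by simp), cnt_const, inter_eq_left.2 sdiff_subset, card_sdiff_of_subset hB]
      have := card_le_card hB
      omega
    · rw [hv₂ i (by simp), cnt_const]
  · exact envyBounded_of_size_le_one ha hd (hv₁ i (by simp [hi]) M hB).le

theorem exists_of_few_items [Nonempty α] (hcard : Fintype.card α = p + 1)
    (ha : 0 ≤ a) (hd : 0 ≤ d) (hL : ∀ i, L i ⊆ M) (hM : #M ≤ 2 * p + 1) :
    ∃ w : ι → α, ∀ i j, i ≠ j → EnvyBounded p a d M L w i j := by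
  by_cases hMp : #M ≤ p
  · obtain ⟨w, hw⟩ := exists_equitable_assignment (α := α) M (q := 0) (by simp) (by omega)
    exact ⟨w, fun i j _ => envyBounded_of_size_le_one ha hd (hw i).2⟩
  let u : α := Classical.arbitrary α
  by_cases hu : p ≤ #(L u)
  · obtain ⟨B, hB, hBp⟩ := exists_subset_card_eq hu
    refine exists_of_all_but_one hcard ha hd u (hB.trans (hL u)) hBp fun w j h₁ _ h₃ h₄ => ?_
    have := h₄ hB
    exact envyBounded_of_size ha hd (by rw [h₃]; omega) (by rw [this]; omega)
  · obtain ⟨B, hLB, hB, hBp⟩ := exists_subsuperset_card_eq (hL u) (n := p) (by omega) (by omega)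
    refine exists_of_all_but_one hcard ha hd u hB hBp fun w j h₁ h₂ h₃ _ => ?_
    refine envyBounded_of_counts ha hd (by rw [h₃]; omega) ?_
    have : (M \ B) ∩ L u = ∅ := by
      ext e
      have := @hLB e
      simp only [mem_inter, mem_sdiff, notMem_empty, iff_false]
      tauto
    rw [h₂, this]
    simp

theorem exists_of_medium (hcard : Fintype.card α = p + 1) (hp : 3 ≤ p) (ha : 0 ≤ a) {s : ℕ}
    (hM : #M ≤ (p + 1) * s + p) (hds : (p - 1 : ℝ) * s * a ≤ d) (hL : ∀ i, L i ⊆ M) {u : α}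
    (hu : p ≤ #(L u)) (hu' : #(L u) + 2 ≤ 2 * p) :
    ∃ w : ι → α, ∀ i j, i ≠ j → EnvyBounded p a d M L w i j := by
  have hp' : (3 : ℝ) ≤ p := by exact_mod_cast hp
  have hsa : 0 ≤ (s : ℝ) * a := by positivity
  have hd : 0 ≤ d := by nlinarith
  obtain ⟨B, hB, hBp⟩ := exists_subset_card_eq hu
  refine exists_of_all_but_one hcard ha hd u (hB.trans (hL u)) hBp fun w j h₁ h₂ h₃ h₄ => ?_
  have h₄ := h₄ hB
  have h₅ : #((M \ B) ∩ L u) + p = #(L u) := by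
    have : (M \ B) ∩ L u = L u \ B := by
      ext e
      have := @hL u e
      simp only [mem_inter, mem_sdiff]
      tauto
    rw [this, card_sdiff_of_subset hB, hBp]
    omega
  have h₆ : (cnt M w u (L u) : ℝ) + 2 ≤ p := by
    have : cnt M w u (L u) + 2 ≤ p := by omega
    exact_mod_cast this
  have h₇ : (cnt M w u M : ℝ) ≤ (p + 1) * s := by
    have : cnt M w u M ≤ (p + 1) * s := by omega
    exact_mod_cast this
  refine envyBounded_of_cost hd ?_
  rw [h₃, h₄]
  push_cast
  have h₈ := mul_le_mul_of_nonneg_right h₆ hd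
  have h₉ := mul_le_mul_of_nonneg_right h₇ ha
  nlinarith

/-- A nearly balanced assignment to the agents of `N` in which everyone finds the own items
small. -/
theorem exists_small_assignment {T : Finset ι} {N : Finset α} (hN : N.Nonempty) {c : ℕ}
    (h : ∀ e ∈ T, ∃ i ∈ N, e ∉ L i) (hc : ∀ i ∈ N, #{e ∈ T | e ∈ L i} ≤ c)
    (hT : c + #N ≤ #T) :
    ∃ w : ι → α, (∀ e ∈ T, w e ∈ N ∧ e ∉ L (w e)) ∧ (∀ i ∈ N, 1 ≤ cnt T w i T) ∧
      ∀ i ∈ N, ∀ j ∈ N, cnt T w i T ≤ cnt T w j T + c + 1 := by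
  obtain ⟨i₀, -⟩ := hN
  have hex : ∃ w : ι → α, ∀ e ∈ T, w e ∈ N ∧ e ∉ L (w e) := by
    have : ∀ e, ∃ i, e ∈ T → i ∈ N ∧ e ∉ L i := fun e => by
      by_cases he : e ∈ T
      · obtain ⟨i, hi⟩ := h e he
        exact ⟨i, fun _ => hi⟩
      · exact ⟨i₀, fun h => (he h).elim⟩
    choose w hw using this
    exact ⟨w, hw⟩
  obtain ⟨w, hw, hmin⟩ := exists_lex_min hex (fun w => ∑ i, (cnt T w i T) ^ 2) 0 0
  have key : ∀ i, ∀ j ∈ N, cnt T w j T + 2 ≤ cnt T w i T → ∀ e ∈ T, w e = i → e ∈ L j := by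
    intro i j hj hij e he hei
    by_contra hej
    have hne : i ≠ j := by rintro rfl; omega
    have hle := (hmin (Function.update w e j) fun f hf => by
      by_cases hfe : f = e
      · subst hfe; simpa using ⟨hj, hej⟩
      · rw [Function.update_of_ne hfe]; exact hw f hf).1
    exact hle.not_gt (sum_sq_cnt_update_lt he (hei ▸ hij))
  have hlarge : ∀ i, ∀ j ∈ N, cnt T w j T + 2 ≤ cnt T w i T → cnt T w i T ≤ c := by
    intro i j hj hij
    refine le_trans (card_le_card fun e he => ?_) (hc j hj)
    simp only [mem_filter] at he ⊢
    exact ⟨he.1, key i j hj hij e he.1 he.2.1⟩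
  refine ⟨w, hw, fun j hj => ?_, fun i _ j hj => ?_⟩
  · by_contra! hj0
    have hinj : #{e ∈ T | e ∉ L j} ≤ #(N.erase j) := by
      refine card_le_card_of_injOn w (fun e he => ?_) fun e he f hf hef => ?_
      · simp only [coe_filter, Set.mem_ofPred_eq] at he
        simp only [coe_erase, Set.mem_sdiff, mem_coe, Set.mem_singleton_iff]
        refine ⟨(hw e he.1).1, fun hej => ?_⟩
        have : 0 < cnt T w j T := card_pos.2 ⟨e, by simp [he.1, hej]⟩
        omega
      · simp only [coe_filter, Set.mem_ofPred_eq] at he hf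
        by_contra hne
        refine he.2 (key (w e) j hj ?_ e he.1 rfl)
        have : 1 < cnt T w (w e) T := one_lt_card.2
          ⟨e, by simp [he.1], f, by simp [hf.1, hef], hne⟩
        omega
    have hsplit := card_filter_add_card_filter_not (s := T) (fun e => e ∈ L j)
    have := hc j hj
    rw [card_erase_of_mem hj] at hinj
    have : 0 < #N := card_pos.2 ⟨j, hj⟩
    omega
  · by_contra! hlt
    have := hlarge i j hj (by omega)
    omega

end Cases


section Regime

variable [Fintype α] {p s : ℕ} {a d : ℝ} {M : Finset ι} {L : α → Finset ι}

theorem exists_minimal_common (hp : 1 ≤ p) (hcard : Fintype.card α = p + 1)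
    (hl : ∀ i, #(L i) + 1 ≤ p) :
    ∃ N : Finset α, 2 ≤ #N ∧ #{e ∈ M | ∀ i ∈ N, e ∈ L i} + #N = p + 1 := by
  obtain ⟨N, ⟨hN, hge⟩, hmin⟩ := exists_lex_min
    (P := fun N : Finset α => N.Nonempty ∧ p + 1 ≤ #{e ∈ M | ∀ i ∈ N, e ∈ L i} + #N)
    ⟨univ, by rw [← card_pos, card_univ]; omega, by rw [card_univ]; omega⟩ card 0 0
  have hpos := card_pos.2 hN
  have h2 : 2 ≤ #N := by
    by_contra! h
    obtain ⟨u, rfl⟩ := card_eq_one.1 (show #N = 1 by omega)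
    have : #{e ∈ M | ∀ i ∈ ({u} : Finset α), e ∈ L i} ≤ #(L u) := card_le_card fun e he => by
      simp only [mem_filter, mem_singleton, forall_eq] at he
      exact he.2
    have := hl u
    rw [card_singleton] at hge
    omega
  refine ⟨N, h2, le_antisymm ?_ hge⟩
  obtain ⟨x, hx⟩ := hN
  by_contra! h
  have hc := card_erase_of_mem hx
  have hmono : #{e ∈ M | ∀ i ∈ N, e ∈ L i} ≤ #{e ∈ M | ∀ i ∈ N.erase x, e ∈ L i} :=
    card_le_card fun e he => by
      simp only [mem_filter] at he ⊢
      exact ⟨he.1, fun i hi => he.2 i (mem_of_mem_erase hi)⟩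
  have := (hmin (N.erase x) ⟨card_pos.1 (by omega), by omega⟩).1
  omega

theorem exists_of_few_large (hp : 3 ≤ p) (hcard : Fintype.card α = p + 1) (ha : 0 ≤ a)
    (hs : 2 ≤ s) (hM₁ : (p + 1) * s ≤ #M) (hM₂ : #M ≤ (p + 1) * s + p)
    (hds : (p - 1 : ℝ) * s * a ≤ d) (hl : ∀ i, #(L i) + 1 ≤ p) :
    ∃ w : ι → α, ∀ i j, i ≠ j → EnvyBounded p a d M L w i j := by
  have hp' : (3 : ℝ) ≤ p := by exact_mod_cast hp
  have hsa : 0 ≤ (s : ℝ) * a := by positivity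
  have hd : 0 ≤ d := by nlinarith
  obtain ⟨N, hN2, hN⟩ := exists_minimal_common (by omega) hcard hl
  set B : Finset ι := {e ∈ M | ∀ i ∈ N, e ∈ L i} with hB
  have hBM : B ⊆ M := filter_subset _ _
  have hBL : ∀ i ∈ N, B ⊆ L i := fun i hi e he => (mem_filter.1 he).2 i hi
  have hTc := card_sdiff_of_subset hBM
  have hps : (p + 1) * 2 ≤ (p + 1) * s := Nat.mul_le_mul_left _ hs
  obtain ⟨w, hw, hw₁, hw₂⟩ := exists_small_assignment (T := M \ B) (L := L) (N := N)
    (card_pos.1 (by omega)) (c := #N - 2) (fun e he => by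
      by_contra! h
      simp only [hB, mem_sdiff, mem_filter, not_and] at he
      exact he.2 he.1 h) (fun i hi => by
      have : {e ∈ M \ B | e ∈ L i} ⊆ L i \ B := fun e he => by
        simp only [mem_filter, mem_sdiff] at he ⊢; tauto
      have h₁ := card_le_card this
      rw [card_sdiff_of_subset (hBL i hi)] at h₁
      have := hl i
      omega) (by omega)
  obtain ⟨v, hv₁, hv₂⟩ := exists_singletons (A := Nᶜ) (w := w) hBM
    (by rw [card_compl, hcard]; omega) (fun e he => by simpa using (hw e he).1)
  have hsz : ∀ i ∈ N, cnt M v i M = cnt (M \ B) w i (M \ B) := fun i hi => by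
    rw [hv₂ i (by simpa using hi)]
    unfold cnt
    congr 1
    apply filter_congr
    intro e he
    simp [he, (mem_sdiff.1 he).1]
  refine ⟨v, fun i j hij => ?_⟩
  by_cases hi : i ∈ N
  swap
  · exact envyBounded_of_size_le_one ha hd (hv₁ i (by simpa using hi) M hBM).le
  have hown : cnt M v i (L i) = 0 := by
    rw [hv₂ i (by simpa using hi), cnt, card_eq_zero, filter_eq_empty_iff]
    rintro e he ⟨rfl, heL⟩
    exact (hw e he).2 heL
  by_cases hj : j ∈ N
  · refine envyBounded_of_counts ha hd ?_ (by omega)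
    rw [hsz i hi, hsz j hj]
    have h₁ := hw₁ j hj
    have h₂ := hw₂ i hi j hj
    have h₃ : p - 1 ≤ (p - 1) * cnt (M \ B) w j (M \ B) := Nat.le_mul_of_pos_right _ h₁
    have h₄ : p * cnt (M \ B) w j (M \ B) =
        (p - 1) * cnt (M \ B) w j (M \ B) + cnt (M \ B) w j (M \ B) := by
      obtain ⟨r, rfl⟩ : ∃ r, p = r + 1 := ⟨p - 1, by omega⟩
      simp; ring
    omega
  · have hj' : j ∈ Nᶜ := by simpa using hj
    refine envyBounded_of_cost hd ?_
    rw [hown, hv₁ j hj' M hBM, hv₁ j hj' (L i) (hBL i hi)]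
    have hle : cnt M v i M ≤ (p + 1) * s + p := (card_le_card (filter_subset _ _)).trans hM₂
    have hle' : (cnt M v i M : ℝ) ≤ (p + 1) * s + p := by exact_mod_cast hle
    have := mul_le_mul_of_nonneg_right hle' ha
    have : (p : ℝ) * ((p - 1) * s * a) ≤ p * d := by gcongr
    push_cast
    nlinarith [mul_nonneg (by nlinarith : (0 : ℝ) ≤ p * (p - 1) - (p + 1)) hsa]

/-- Almost halving a set with respect to both `S` and its complement. -/
theorem exists_halves (R S : Finset ι) : ∃ P ⊆ R, 2 * #(P ∩ S) ≤ #(R ∩ S) ∧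
    #(R ∩ S) ≤ 2 * #(P ∩ S) + 1 ∧ 2 * #P ≤ #R ∧ #R ≤ 2 * #P + 2 := by
  obtain ⟨P₁, h₁, hc₁⟩ := exists_subset_card_eq (s := R ∩ S) (n := #(R ∩ S) / 2) (by omega)
  obtain ⟨P₂, h₂, hc₂⟩ := exists_subset_card_eq (s := R \ S) (n := #(R \ S) / 2) (by omega)
  have hR := card_inter_add_card_sdiff R S
  have hdisj : Disjoint P₁ P₂ := disjoint_of_subset_left (h₁.trans inter_subset_right)
    (disjoint_of_subset_right h₂ disjoint_sdiff)
  have hPS : (P₁ ∪ P₂) ∩ S = P₁ := by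
    ext e
    have := @h₁ e
    have := @h₂ e
    simp only [mem_inter, mem_union, mem_sdiff] at *
    tauto
  refine ⟨P₁ ∪ P₂, union_subset (h₁.trans inter_subset_left) (h₂.trans sdiff_subset), ?_⟩
  rw [hPS, card_union_of_disjoint hdisj]
  omega

/-- Two agents, one of whom has many large items, divide everything but a set `B` of items that
both consider large by cut and choose. -/
theorem exists_of_cut_and_choose (hp : 3 ≤ p) (hcard : Fintype.card α = p + 1) (ha : 0 ≤ a)
    (hM : #M ≤ (p + 1) * s + p) (hds : (p - 1 : ℝ) * s * a ≤ d) (hL : ∀ i, L i ⊆ M)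
    {u j : α} (huj : u ≠ j) (hu₁ : 2 * p ≤ #(L u) + 1) (hu₂ : #(L u) ≤ 2 * p)
    (hj₂ : #(L j) ≤ 2 * p) {B : Finset ι} (hBu : B ⊆ L u) (hBj : B ⊆ L j) (hBp : #B + 1 = p) :
    ∃ w : ι → α, ∀ i j, i ≠ j → EnvyBounded p a d M L w i j := by
  have hp' : (3 : ℝ) ≤ p := by exact_mod_cast hp
  have hsa : 0 ≤ (s : ℝ) * a := by positivity
  have hd : 0 ≤ d := by nlinarith
  have hBM : B ⊆ M := hBu.trans (hL u)
  set R := M \ B with hR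
  have hRc : #R + p = #M + 1 := by
    have : #R = _ := card_sdiff_of_subset hBM
    have := card_le_card hBM
    omega
  have hRL : ∀ i, B ⊆ L i → #(R ∩ L i) + p = #(L i) + 1 := fun i hi => by
    have : R ∩ L i = L i \ B := by
      ext e
      have := @hL i e
      simp only [hR, mem_inter, mem_sdiff]
      tauto
    have h₁ := card_sdiff_of_subset hi
    have h₂ := card_le_card hi
    rw [this]
    omega
  -- the cost of a set for agent `j`
  let κ : Finset ι → ℝ := fun S => #S * a + #(S ∩ L j) * d
  obtain ⟨P, hPR, hP₁, hP₂, hP₃, hP₄, hP₅⟩ : ∃ P ⊆ R, 2 * #(P ∩ L u) ≤ #(R ∩ L u) + 1 ∧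
      #(R ∩ L u) ≤ 2 * #(P ∩ L u) + 1 ∧ 2 * #P ≤ #R + 2 ∧ #R ≤ 2 * #P + 2 ∧
      κ P ≤ κ (R \ P) := by
    obtain ⟨P, hPR, h₁, h₂, h₃, h₄⟩ := exists_halves R (L u)
    by_cases hκ : κ P ≤ κ (R \ P)
    · exact ⟨P, hPR, by omega, h₂, by omega, h₄, hκ⟩
    · have hc := card_sdiff_of_subset hPR
      have hc' := card_le_card hPR
      have hi : #((R \ P) ∩ L u) = #(R ∩ L u) - #(P ∩ L u) := by
        rw [← card_sdiff_of_subset (inter_subset_inter_right hPR)]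
        congr 1
        ext e
        simp only [mem_inter, mem_sdiff]
        tauto
      refine ⟨R \ P, sdiff_subset, by omega, by omega, by omega, by omega, ?_⟩
      rw [Finset.sdiff_sdiff_eq_self hPR]
      exact (not_le.1 hκ).le
  obtain ⟨v, hv₁, hv₂⟩ := exists_singletons (A := ({u, j} : Finset α)ᶜ)
    (w := fun e => if e ∈ P then j else u) hBM
    (by rw [card_compl, hcard, card_pair huj]; omega) (fun e _ => by
      simp only [mem_compl, not_not, mem_insert, mem_singleton]; split_ifs <;> simp)
  have hvj : ∀ S, cnt M v j S = #(P ∩ S) := fun S => by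
    rw [hv₂ j (by simp), cnt]
    congr 1
    ext e
    have := @hPR e
    by_cases heP : e ∈ P
    · simp [heP, hR.symm, this heP]
    · simp [heP, huj]
  have hvu : ∀ S, cnt M v u S = #((R \ P) ∩ S) := fun S => by
    rw [hv₂ u (by simp), cnt]
    congr 1
    ext e
    by_cases heP : e ∈ P
    · simp [heP, huj.symm]
    · simp [heP, hR.symm]
  have hRM : R ⊆ M := sdiff_subset
  have hPM : P ∩ M = P := inter_eq_left.2 (hPR.trans hRM)
  have hQM : (R \ P) ∩ M = R \ P := inter_eq_left.2 (sdiff_subset.trans hRM)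
  have hsplit : ∀ i, #((R \ P) ∩ L i) + #(P ∩ L i) = #(R ∩ L i) := fun i => by
    rw [← card_union_of_disjoint]
    · congr 1
      ext e
      have := @hPR e
      simp only [mem_inter, mem_union, mem_sdiff]
      tauto
    · exact disjoint_of_subset_left inter_subset_left
        (disjoint_of_subset_right inter_subset_left sdiff_disjoint)
  have hsplit' : #(R \ P) + #P = #R := card_sdiff_add_card_eq_card hPR
  have hRs : #R ≤ (p + 1) * s + 1 := by omega
  have hRs' : (#R : ℝ) ≤ (p + 1) * s + 1 := by exact_mod_cast hRs
  have hpp : (p + 1 : ℝ) * (s * a) ≤ (p - 1) * d := by nlinarith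
  have hju : κ P ≤ p * (a + d) + a := by
    have h₁ : (#(R \ P) : ℝ) + #P = #R := by exact_mod_cast hsplit'
    have h₂ : (#((R \ P) ∩ L j) : ℝ) + #(P ∩ L j) = #(R ∩ L j) := by exact_mod_cast hsplit j
    have h₃ : (#(R ∩ L j) : ℝ) ≤ p + 1 := by
      have := hRL j hBj
      have : #(R ∩ L j) ≤ p + 1 := by omega
      exact_mod_cast this
    have h₄ : 2 * κ P ≤ #R * a + #(R ∩ L j) * d := by
      rw [← h₁, ← h₂]
      simp only [κ] at hP₅ ⊢
      linarith
    nlinarith [mul_le_mul_of_nonneg_right h₃ hd, mul_le_mul_of_nonneg_right hRs' ha]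
  have huu : (#(R \ P) : ℝ) * a + #((R \ P) ∩ L u) * d ≤ p * (a + d) + a := by
    have h₁ : 2 * #(R \ P) ≤ #R + 2 := by omega
    have h₁' : 2 * (#(R \ P) : ℝ) ≤ #R + 2 := by exact_mod_cast h₁
    have h₂ := hsplit u
    have h₃ := hRL u hBu
    have h₄ := mul_le_mul_of_nonneg_right h₁' ha
    have h₅ := mul_le_mul_of_nonneg_right hRs' ha
    rcases hp.eq_or_lt with rfl | hp4
    · have h₆ : #((R \ P) ∩ L u) ≤ 2 := by omega
      have h₆' : (#((R \ P) ∩ L u) : ℝ) ≤ 2 := by exact_mod_cast h₆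
      have := mul_le_mul_of_nonneg_right h₆' hd
      push_cast at *
      nlinarith
    · have h₆ : 2 * #((R \ P) ∩ L u) ≤ p + 2 := by omega
      have h₆' : 2 * (#((R \ P) ∩ L u) : ℝ) ≤ p + 2 := by exact_mod_cast h₆
      have := mul_le_mul_of_nonneg_right h₆' hd
      have hp4' : (4 : ℝ) ≤ p := by exact_mod_cast hp4
      have : (p + 1 : ℝ) * (s * a) ≤ (p - 2) * d := by
        have h₇ : (p - 2) * ((p - 1) * s * a) ≤ (p - 2) * d :=
          mul_le_mul_of_nonneg_left hds (by linarith)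
        nlinarith [mul_nonneg (by nlinarith : (0 : ℝ) ≤ (p - 2) * (p - 1) - (p + 1)) hsa]
      nlinarith
  refine ⟨v, fun x y hxy => ?_⟩
  by_cases hxu : x = u
  · subst hxu
    refine envyBounded_of_cost hd ?_
    rw [hvu, hvu, hQM]
    refine huu.trans (add_le_add_left (mul_le_mul_of_nonneg_left ?_ (by linarith)) a)
    by_cases hyj : y = j
    · subst hyj
      rw [hvj, hvj, hPM]
      have h₁ : 1 ≤ #(P ∩ L x) := by have := hRL x hBu; omega
      have h₂ : 1 ≤ #P := h₁.trans (card_le_card inter_subset_left)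
      have h₁' : (1 : ℝ) ≤ #(P ∩ L x) := by exact_mod_cast h₁
      have h₂' : (1 : ℝ) ≤ #P := by exact_mod_cast h₂
      nlinarith
    · have hy : y ∈ ({x, j} : Finset α)ᶜ := by simp [hxy.symm, hyj]
      rw [hv₁ y hy M hBM, hv₁ y hy (L x) hBu]
      simp
  by_cases hxj : x = j
  · subst hxj
    refine envyBounded_of_cost hd ?_
    rw [hvj, hvj, hPM]
    by_cases hyu : y = u
    · subst hyu
      rw [hvu, hvu, hQM]
      simp only [κ] at hP₅
      have : 0 ≤ (#(R \ P) : ℝ) * a + #((R \ P) ∩ L x) * d := by positivity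
      nlinarith
    · have hy : y ∈ ({u, x} : Finset α)ᶜ := by simp [hxy.symm, hyu]
      rw [hv₁ y hy M hBM, hv₁ y hy (L x) hBj]
      simpa [κ] using hju
  · have hx : x ∈ ({u, j} : Finset α)ᶜ := by simp [hxu, hxj]
    exact envyBounded_of_size_le_one ha hd (hv₁ x hx M hBM).le

theorem exists_of_many_large (hp : 3 ≤ p) (hcard : Fintype.card α = p + 1) (hs : 2 ≤ s)
    (hM₁ : (p + 1) * s ≤ #M) (hM₂ : #M ≤ (p + 1) * s + p) {N : Finset α}
    (hN : N.Nonempty) (h₁ : p + 1 ≤ #{e ∈ M | ∀ i ∈ N, e ∈ L i})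
    (h₂ : ∀ Z : Finset α, Z.Nonempty → Disjoint N Z →
      #Z + #{e ∈ M | ∀ i ∈ N ∪ Z, e ∈ L i} ≤ #{e ∈ M | ∀ i ∈ N, e ∈ L i})
    (ha : 0 ≤ a) (hd : 0 ≤ d) :
    ∃ w : ι → α, ∀ i j, i ≠ j → EnvyBounded p a d M L w i j := by
  obtain ⟨ε, hε, hεM, hεN, hεL⟩ := exists_distinct_items (hcard ▸ h₁) h₂
  obtain ⟨r, rfl⟩ : ∃ r, s = r + 1 := ⟨s - 1, by omega⟩
  obtain ⟨w, hw⟩ := exists_of_distinct_items hp hcard hN (s := r) (by omega) hM₁ hM₂ hε hεM hεN hεL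
  exact ⟨w, fun i j hij => envyBounded_of_counts ha hd (hw i j hij).1 (hw i j hij).2⟩

theorem exists_of_le_mul (hp : 3 ≤ p) (hcard : Fintype.card α = p + 1) (ha : 0 ≤ a) (hs : 2 ≤ s)
    (hM₁ : (p + 1) * s ≤ #M) (hM₂ : #M ≤ (p + 1) * s + p)
    (hds : (p - 1 : ℝ) * s * a ≤ d) (hL : ∀ i, L i ⊆ M) :
    ∃ w : ι → α, ∀ i j, i ≠ j → EnvyBounded p a d M L w i j := by
  have hp' : (3 : ℝ) ≤ p := by exact_mod_cast hp
  have hsa : 0 ≤ (s : ℝ) * a := by positivity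
  have hd : 0 ≤ d := by nlinarith
  have hsingle : ∀ u, #{e ∈ M | ∀ i ∈ ({u} : Finset α), e ∈ L i} = #(L u) := fun u => by
    congr 1
    ext e
    simpa using @hL u e
  by_cases h₁ : ∃ u, 2 * p + 1 ≤ #(L u)
  · obtain ⟨u, hu⟩ := h₁
    obtain ⟨N, hN, hmax⟩ := exists_max_image (univ.filter fun N : Finset α => N.Nonempty)
      (fun N => #{e ∈ M | ∀ i ∈ N, e ∈ L i} + #N) ⟨{u}, by simp⟩
    have hNne : N.Nonempty := (mem_filter.1 hN).2
    refine exists_of_many_large hp hcard hs hM₁ hM₂ hNne ?_ (fun Z _ hNZ => ?_) ha hd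
    · have := hmax {u} (by simp)
      rw [hsingle, card_singleton] at this
      have := card_le_univ N
      omega
    · have := hmax (N ∪ Z) (by simp [hNne.mono subset_union_left])
      rw [card_union_of_disjoint hNZ] at this
      omega
  push Not at h₁
  by_cases h₂ : ∃ u, 2 * p ≤ #(L u) + 1
  · obtain ⟨u, hu⟩ := h₂
    by_cases h₃ : ∃ j, u ≠ j ∧ p ≤ #(L u ∩ L j) + 1
    · obtain ⟨j, huj, hj⟩ := h₃
      obtain ⟨B, hB, hBc⟩ := exists_subset_card_eq (s := L u ∩ L j) (n := p - 1) (by omega)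
      have := h₁ u
      have := h₁ j
      exact exists_of_cut_and_choose hp hcard ha hM₂ hds hL huj hu (by omega) (by omega)
        (hB.trans inter_subset_left) (hB.trans inter_subset_right) (by omega)
    · push Not at h₃
      refine exists_of_many_large hp hcard hs hM₁ hM₂ (singleton_nonempty u)
        (by rw [hsingle]; omega) (fun Z hZ hdisj => ?_) ha hd
      rw [hsingle]
      obtain ⟨j, hj⟩ := hZ
      have huZ : u ∉ Z := disjoint_singleton_left.1 hdisj
      have hZc : #Z ≤ #(univ.erase u) := card_le_card fun i hi => by
        simp only [mem_erase, mem_univ, and_true]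
        rintro rfl; exact huZ hi
      rw [card_erase_of_mem (mem_univ _), card_univ] at hZc
      have := h₃ j (by rintro rfl; exact huZ hj)
      have : #{e ∈ M | ∀ i ∈ {u} ∪ Z, e ∈ L i} ≤ #(L u ∩ L j) := card_le_card fun e he => by
        simp only [mem_filter] at he
        exact mem_inter.2 ⟨he.2 u (by simp), he.2 j (by simp [hj])⟩
      omega
  push Not at h₂
  by_cases h₃ : ∃ u, p ≤ #(L u)
  · obtain ⟨u, hu⟩ := h₃
    exact exists_of_medium hcard hp ha hM₂ hds hL hu (by have := h₂ u; omega)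
  · push Not at h₃
    exact exists_of_few_large hp hcard ha hs hM₁ hM₂ hds h₃

theorem exists_envyBounded [Nonempty α] (hp : 3 ≤ p) (hcard : Fintype.card α = p + 1)
    (ha : 0 ≤ a) (hd : 0 ≤ d) (hL : ∀ i, L i ⊆ M) :
    ∃ w : ι → α, ∀ i j, i ≠ j → EnvyBounded p a d M L w i j := by
  by_cases hM : #M ≤ 2 * p + 1
  · exact exists_of_few_items hcard ha hd hL hM
  obtain ⟨s, r, hr, hsr⟩ : ∃ s r, r < p + 1 ∧ #M = (p + 1) * s + r :=
    ⟨#M / (p + 1), #M % (p + 1), Nat.mod_lt _ (by omega), (Nat.div_add_mod _ _).symm⟩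
  have hs : 2 ≤ s := by
    by_contra! h
    have : (p + 1) * s ≤ (p + 1) * 1 := Nat.mul_le_mul_left _ (by omega)
    omega
  by_cases hds : (p - 1 : ℝ) * s * a ≤ d
  · exact exists_of_le_mul hp hcard ha hs (by omega) (by omega) hds hL
  have hexp : (p + 1) * (s + 1) = (p + 1) * s + (p + 1) := by ring
  obtain ⟨w, hw⟩ := exists_extremal (α := α) M L (q := s)
    (by rw [hcard]; omega) (by rw [hcard]; omega)
  refine ⟨w, fun i j hij => ?_⟩
  have hl := hw.own_le hij
  have hi := hw.balanced i
  have hj := hw.balanced j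
  have h₁ : p * s ≤ p * cnt M w j M := Nat.mul_le_mul_left _ hj.1
  have h₂ : 3 * s ≤ p * s := Nat.mul_le_mul_right _ hp
  have h₃ : 3 * cnt M w j (L i) ≤ p * cnt M w j (L i) := Nat.mul_le_mul_right _ hp
  by_cases hl' : cnt M w i (L i) ≤ p * cnt M w j (L i)
  · exact envyBounded_of_counts ha hd (by omega) hl'
  · have hg : cnt M w j (L i) = 0 := by omega
    have hl1 : cnt M w i (L i) = 1 := by omega
    refine envyBounded_of_cost hd ?_
    rw [hg, hl1]
    have h₄ : (cnt M w i M : ℝ) ≤ s + 1 := by exact_mod_cast hi.2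
    have h₅ : (p : ℝ) * s ≤ p * cnt M w j M := by exact_mod_cast h₁
    push_cast
    nlinarith [mul_le_mul_of_nonneg_right h₄ ha, mul_le_mul_of_nonneg_right h₅ ha]

end Regime

end Counting

theorem sum_ite_large {ι : Type*} [DecidableEq ι] (S L : Finset ι) (a d : ℝ) :
    ∑ e ∈ S, (a + if e ∈ L then d else 0) = #S * a + #{e ∈ S | e ∈ L} * d := by
  rw [sum_add_distrib, sum_const, ← sum_filter, sum_const]
  simp

theorem exists_efx_of_le {ι : Type*} [DecidableEq ι] (n : ℕ) (hn : 4 ≤ n) (M : Finset ι)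
    (c : Fin n → ι → ℝ) (a b : ℝ) (ha : 0 ≤ a) (hab : a ≤ b)
    (hbi : ∀ i, ∀ e ∈ M, c i e = a ∨ c i e = b) :
    ∃ X : Fin n → Finset ι,
      (∀ i j, i ≠ j → Disjoint (X i) (X j)) ∧
      (Finset.univ.biUnion X = M) ∧
      (∀ i j : Fin n, ∀ e ∈ X i,
        ∑ f ∈ (X i).erase e, c i f ≤ ((n : ℝ) - 1) * ∑ f ∈ X j, c i f) := by
  obtain ⟨p, rfl⟩ : ∃ p, n = p + 1 := ⟨n - 1, by omega⟩
  have hp' : (3 : ℝ) ≤ p := by exact_mod_cast (by omega : 3 ≤ p)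
  let L : Fin (p + 1) → Finset ι := fun i => {e ∈ M | c i e ≠ a}
  have hc : ∀ i, ∀ e ∈ M, c i e = a + if e ∈ L i then b - a else 0 := fun i e he => by
    by_cases h : c i e = a
    · simp [L, h]
    · have := (hbi i e he).resolve_left h
      simp only [L, mem_filter, he, true_and, ne_eq, h, not_false_eq_true, if_true]
      linarith
  obtain ⟨w, hw⟩ := exists_envyBounded (α := Fin (p + 1)) (p := p) (a := a) (d := b - a) (M := M)
    (L := L) (by omega) (by simp) ha (by linarith) (fun i => filter_subset _ _)
  have hcost : ∀ i j, ∑ f ∈ M with w f = j, c i f =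
      cnt M w j M * a + cnt M w j (L i) * (b - a) := fun i j => by
    rw [sum_congr rfl fun e he => hc i e (mem_filter.1 he).1, sum_ite_large]
    unfold cnt
    rw [filter_filter]
    congr 4
    apply filter_congr
    simp +contextual
  refine ⟨fun i => {e ∈ M | w e = i}, fun i j hij => ?_, ?_, fun i j e he => ?_⟩
  · rw [disjoint_left]
    intro e hi hj
    exact hij ((mem_filter.1 hi).2.symm.trans (mem_filter.1 hj).2)
  · ext e
    simp
  · obtain ⟨heM, hei⟩ := mem_filter.1 he
    rw [sum_erase_eq_sub he]
    push_cast
    rw [add_sub_cancel_right]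
    by_cases hij : i = j
    · subst hij
      have hnn : ∀ f ∈ M, 0 ≤ c i f := fun f hf => by
        rcases hbi i f hf with h | h <;> rw [h] <;> linarith
      have h₁ := hnn e heM
      have h₂ : 0 ≤ ∑ f ∈ M with w f = i, c i f := sum_nonneg fun f hf =>
        hnn f (mem_filter.1 hf).1
      nlinarith
    · rw [hcost, hcost, hc i e heM]
      exact hw i j hij e heM hei

/-- For every instance with `n ≥ 4` agents, a finite set `M` of indivisible chores,
and additive bi-valued cost functions (there are constants `a, b ≥ 0` with
`c_i(e) ∈ {a, b}` for every agent `i` and item `e`), there exists an `(n-1)`-EFX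
allocation. -/
theorem stmt_17 {ι : Type*} [DecidableEq ι] (n : ℕ) (hn : 4 ≤ n) (M : Finset ι)
    (c : Fin n → ι → ℝ) (a b : ℝ) (ha : 0 ≤ a) (hb : 0 ≤ b)
    (hbi : ∀ i, ∀ e ∈ M, c i e = a ∨ c i e = b) :
    ∃ X : Fin n → Finset ι,
      (∀ i j, i ≠ j → Disjoint (X i) (X j)) ∧
      (Finset.univ.biUnion X = M) ∧
      (∀ i j : Fin n, ∀ e ∈ X i,
        ∑ f ∈ (X i).erase e, c i f ≤ ((n : ℝ) - 1) * ∑ f ∈ X j, c i f) := by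
  rcases le_total a b with hab | hab
  · exact exists_efx_of_le n hn M c a b ha hab hbi
  · exact exists_efx_of_le n hn M c b a hb hab fun i e he => (hbi i e he).symm
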